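/- Let M be a topological space and let p : X̃ → X be a covering map. Then the map π : F₂^X(M × X) → F₂(M × X) given by ((m₁,x₁),(m₂,x₂)) ↦ ((m₁,p(x₁)),(m₂,p(x₂))) is well defined and is a covering map. -/

import Mathlib

/-- The product of two covering maps is a covering map. -/
theorem isCoveringMap_prodMap_aux {E₁ X₁ E₂ X₂ : Type*} [TopologicalSpace E₁]
    [TopologicalSpace X₁] [TopologicalSpace E₂] [TopologicalSpace X₂] {f : E₁ → X₁} {g : E₂ → X₂}
    (hf : IsCoveringMap f) (hg : IsCoveringMap g) : IsCoveringMap (Prod.map f g) := by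
  rintro ⟨x, y⟩
  obtain ⟨_, U, hxU, hU, hfU, H, hH⟩ := hf x
  obtain ⟨_, V, hyV, hV, hgV, K, hK⟩ := hg y
  refine IsEvenlyCovered.to_isEvenlyCovered_preimage (I := (f ⁻¹' {x}) × (g ⁻¹' {y}))
    ⟨inferInstance, U ×ˢ V, ⟨hxU, hyV⟩, hU.prod hV, hfU.prod hgV,
    { toFun := fun e => (⟨Prod.map f g e.1, e.2⟩,
        ((H ⟨e.1.1, e.2.1⟩).2, (K ⟨e.1.2, e.2.2⟩).2))
      invFun := fun w => ⟨((H.symm (⟨w.1.1.1, w.1.2.1⟩, w.2.1)).1,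
        (K.symm (⟨w.1.1.2, w.1.2.2⟩, w.2.2)).1),
        ⟨(H.symm (⟨w.1.1.1, w.1.2.1⟩, w.2.1)).2, (K.symm (⟨w.1.1.2, w.1.2.2⟩, w.2.2)).2⟩⟩
      left_inv := ?_
      right_inv := ?_
      continuous_toFun := ?_
      continuous_invFun := by fun_prop }, fun _ => rfl⟩
  · rintro ⟨⟨a, b⟩, ha, hb⟩
    have h1 : H ⟨a, ha⟩ = (⟨f a, ha⟩, (H ⟨a, ha⟩).2) := Prod.ext (Subtype.ext (hH _)) rfl
    have h2 : K ⟨b, hb⟩ = (⟨g b, hb⟩, (K ⟨b, hb⟩).2) := Prod.ext (Subtype.ext (hK _)) rfl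
    apply Subtype.ext
    apply Prod.ext
    · change (H.symm (⟨f a, ha⟩, (H ⟨a, ha⟩).2)).1 = a
      rw [← h1, H.symm_apply_apply]
    · change (K.symm (⟨g b, hb⟩, (K ⟨b, hb⟩).2)).1 = b
      rw [← h2, K.symm_apply_apply]
  · rintro ⟨⟨⟨a, b⟩, ha, hb⟩, i, j⟩
    have h1 := hH (H.symm (⟨a, ha⟩, i))
    have h2 := hK (K.symm (⟨b, hb⟩, j))
    rw [H.apply_symm_apply] at h1
    rw [K.apply_symm_apply] at h2
    refine Prod.ext (Subtype.ext (Prod.ext h1.symm h2.symm)) (Prod.ext ?_ ?_)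
    · change (H (H.symm (⟨a, ha⟩, i))).2 = i
      rw [H.apply_symm_apply]
    · change (K (K.symm (⟨b, hb⟩, j))).2 = j
      rw [K.apply_symm_apply]
  · have hfc := hf.continuous
    have hgc := hg.continuous
    fun_prop

theorem isCoveringMap_id_aux (M : Type*) [TopologicalSpace M] : IsCoveringMap (id : M → M) := by
  intro x
  exact IsEvenlyCovered.to_isEvenlyCovered_preimage (I := Unit)
    ⟨inferInstance, Set.univ, trivial, isOpen_univ, isOpen_univ,
      (Homeomorph.prodPUnit _).symm, fun _ => rfl⟩


/-- The ordered configuration space of two points. -/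
def conf2 (Y : Type*) [TopologicalSpace Y] : Set (Y × Y) := {y | y.1 ≠ y.2}

/-- Given a covering `p : X̃ → X` and a space `M`, the `X`-orbit configuration space of two
points in `M × X`, realized as a subspace of `(M × X̃) × (M × X̃)`. -/
def orbitConf2X (M : Type*) {Xt X : Type*} [TopologicalSpace M] [TopologicalSpace Xt]
    [TopologicalSpace X] (p : Xt → X) : Set ((M × Xt) × (M × Xt)) :=
  {z | (z.1.1, p z.1.2) ≠ (z.2.1, p z.2.2)}

/-- The projection `π : F₂^X(M × X) → F₂(M × X)`,
`((m₁, x₁), (m₂, x₂)) ↦ ((m₁, p x₁), (m₂, p x₂))`; it is well defined since points of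
`F₂^X(M × X)` project to distinct points of `M × X`. -/
def orbitConf2XProj (M : Type*) {Xt X : Type*} [TopologicalSpace M] [TopologicalSpace Xt]
    [TopologicalSpace X] (p : Xt → X) (z : ↥(orbitConf2X M p)) : ↥(conf2 (M × X)) :=
  ⟨((z.1.1.1, p z.1.1.2), (z.1.2.1, p z.1.2.2)), z.2⟩

/-- If `p : X̃ → X` is a covering map and `M` is a topological space, then the projection
`π : F₂^X(M × X) → F₂(M × X)` is a covering map. -/
theorem isCoveringMap_orbitConf2XProj (M : Type) {Xt X : Type} [TopologicalSpace M]
    [TopologicalSpace Xt] [TopologicalSpace X] (p : Xt → X) (hp : IsCoveringMap p) :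
    IsCoveringMap (orbitConf2XProj M p) := by
  have h := isCoveringMap_prodMap_aux (isCoveringMap_id_aux M) hp
  exact (isCoveringMap_prodMap_aux h h).restrictPreimage (conf2 (M × X))
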